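/- Let r₁,…,rₙ be distinct roots of the characteristic equation P(z)=0 with Re r_k > 0 for all 1 ≤ k ≤ n, and let K_D = (1/|V|)∫₀^∞ |Σ_{k=1}^n (−1)^k V_k e^{−r_k x}| dx. Then every Ulam constant K of D satisfies K ≥ K_D; consequently K_D is the best (smallest) Ulam constant of D. -/

import Mathlib

open MeasureTheory

/-- The linear differential operator `D(y) = y⁽ⁿ⁾ + a₁ y⁽ⁿ⁻¹⁾ + ⋯ + aₙ y`,
where `a j` is the coefficient of `y⁽ⁿ⁻¹⁻ʲ⁾` (zero-based indexing). -/
noncomputable def Dop {X : Type*} [NormedAddCommGroup X] [NormedSpace ℂ X]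
    (n : ℕ) (a : Fin n → ℂ) (y : ℝ → X) : ℝ → X :=
  fun t => iteratedDeriv n y t + ∑ j : Fin n, a j • iteratedDeriv (n - 1 - (j : ℕ)) y t

/-- `K` is an Ulam constant of the operator `D` determined by the coefficients `a`:
for every `ε > 0` and every `n` times continuously differentiable `y` with
`‖D(y)‖_∞ ≤ ε` there is `z ∈ Ker D` with `‖y - z‖_∞ ≤ Kε`. -/
def IsUlamConstant {X : Type*} [NormedAddCommGroup X] [NormedSpace ℂ X]
    (n : ℕ) (a : Fin n → ℂ) (K : ℝ) : Prop :=
  0 ≤ K ∧ ∀ ε : ℝ, 0 < ε → ∀ y : ℝ → X, ContDiff ℝ n y →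
    (∀ t : ℝ, ‖Dop n a y t‖ ≤ ε) →
    ∃ z : ℝ → X, ContDiff ℝ n z ∧ Dop n a z = 0 ∧ ∀ t : ℝ, ‖y t - z t‖ ≤ K * ε

/-- Vandermonde determinant of `r₁, …, rₙ` with the `k`-th entry deleted. -/
noncomputable def VandDel {n : ℕ} (r : Fin (n + 1) → ℂ) (k : Fin (n + 1)) : ℂ :=
  (Matrix.vandermonde fun i : Fin n => r (k.succAbove i)).det

open Polynomial in
/-- The linear map sending a polynomial `p` to `(p(d/dt) y)(t)`, keeping only the derivatives of
order less than `N`. -/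
noncomputable def diffPoly {X : Type*} [NormedAddCommGroup X] [NormedSpace ℂ X]
    (N : ℕ) (y : ℝ → X) (t : ℝ) : ℂ[X] →ₗ[ℂ] X :=
  ∑ i ∈ Finset.range N,
    (LinearMap.toSpanSingleton ℂ X (iteratedDeriv i y t)).comp (Polynomial.lcoeff ℂ i)

section

variable {X : Type*} [NormedAddCommGroup X] [NormedSpace ℂ X]

open Polynomial in
lemma diffPoly_apply (N : ℕ) (y : ℝ → X) (t : ℝ) (p : ℂ[X]) :
    diffPoly N y t p = ∑ i ∈ Finset.range N, p.coeff i • iteratedDeriv i y t := by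
  simp [diffPoly, LinearMap.sum_apply]

lemma diffPoly_X_pow {N i : ℕ} (hi : i < N) (y : ℝ → X) (t : ℝ) :
    diffPoly N y t (Polynomial.X ^ i) = iteratedDeriv i y t := by
  simp [diffPoly_apply, Polynomial.coeff_X_pow, hi]

open Polynomial in
lemma hasDerivAt_diffPoly {N : ℕ} {y : ℝ → X} (hy : ContDiff ℝ N y) {p : ℂ[X]}
    (hp : p.coeff N = 0) (t : ℝ) :
    HasDerivAt (fun s => diffPoly (N + 1) y s p)
      (diffPoly (N + 1) y t (Polynomial.X * p)) t := by
  simp only [diffPoly_apply]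
  rw [Finset.sum_range_succ']
  simp only [Finset.sum_range_succ (fun i => p.coeff i • iteratedDeriv i y _), hp, zero_smul,
    add_zero, Polynomial.coeff_X_mul, Polynomial.mul_coeff_zero, Polynomial.coeff_X_zero, zero_mul]
  refine HasDerivAt.fun_sum fun i hi => HasDerivAt.const_smul _ ?_
  rw [iteratedDeriv_succ]
  exact ((contDiff_nat_iff_iteratedDeriv.1 hy).2 i (Finset.mem_range.1 hi) t).hasDerivAt

lemma eq_exp_smul_of_hasDerivAt {w : ℝ → X} {r : ℂ} (hw : ∀ t, HasDerivAt w (r • w t) t) (t : ℝ) :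
    w t = Complex.exp (r * t) • w 0 := by
  have hexp (s : ℝ) : HasDerivAt (fun s : ℝ => Complex.exp (-r * s))
      (Complex.exp (-r * s) * -r) s := by
    simpa using ((Complex.ofRealCLM.hasDerivAt (x := s)).const_mul (-r)).cexp
  have hd (s : ℝ) : HasDerivAt (fun s : ℝ => Complex.exp (-r * s) • w s) 0 s := by
    refine ((hexp s).smul (hw s)).congr_deriv ?_
    rw [smul_smul, ← add_smul]
    simp
  have hc := is_const_of_deriv_eq_zero (fun s => (hd s).differentiableAt)
    (fun s => (hd s).deriv) t 0
  simp only [Complex.ofReal_zero, mul_zero, Complex.exp_zero, one_smul] at hc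
  rw [← hc, smul_smul, ← Complex.exp_add]
  simp

/-- The characteristic polynomial of `Dop (n + 1) a`. -/
noncomputable def charPoly {n : ℕ} (a : Fin (n + 1) → ℂ) : Polynomial ℂ :=
  Polynomial.X ^ (n + 1) + ∑ j : Fin (n + 1), a j • Polynomial.X ^ (n - (j : ℕ))

lemma Dop_eq_diffPoly {n : ℕ} (a : Fin (n + 1) → ℂ) (y : ℝ → X) (t : ℝ) :
    Dop (n + 1) a y t = diffPoly (n + 2) y t (charPoly a) := by
  rw [charPoly, map_add, map_sum, diffPoly_X_pow (by omega), Dop]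
  congr 1
  refine Finset.sum_congr rfl fun j _ => ?_
  rw [map_smul, diffPoly_X_pow (by omega)]
  rfl

lemma charPoly_eq_nodal {n : ℕ} {a r : Fin (n + 1) → ℂ}
    (hroot : ∀ k, r k ^ (n + 1) + ∑ j : Fin (n + 1), a j * r k ^ (n - (j : ℕ)) = 0)
    (hinj : Function.Injective r) :
    charPoly a = Lagrange.nodal Finset.univ r := by
  have hlt : (∑ j : Fin (n + 1), a j • (Polynomial.X : Polynomial ℂ) ^ (n - (j : ℕ))).degree
      < ((n + 1 : ℕ) : WithBot ℕ) := by
    refine (Polynomial.degree_sum_le _ _).trans_lt ?_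
    rw [Finset.sup_lt_iff (WithBot.bot_lt_coe _)]
    intro j _
    refine (Polynomial.degree_smul_le _ _).trans_lt ?_
    rw [Polynomial.degree_X_pow]
    exact_mod_cast (by omega : n - (j : ℕ) < n + 1)
  have hmon : (charPoly a).Monic := Polynomial.monic_X_pow_add hlt
  have hdeg : (charPoly a).degree = ((n + 1 : ℕ) : WithBot ℕ) := by
    rw [charPoly, Polynomial.degree_add_eq_left_of_degree_lt (by rwa [Polynomial.degree_X_pow]),
      Polynomial.degree_X_pow]
  refine Polynomial.eq_of_degree_le_of_eval_index_eq (v := r) Finset.univ hinj.injOn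
    (by simp [hdeg]) (by simp [hdeg, Lagrange.degree_nodal]) ?_ fun k _ => ?_
  · rw [hmon.leadingCoeff, Lagrange.nodal_monic.leadingCoeff]
  · rw [Lagrange.eval_nodal_at_node (Finset.mem_univ k)]
    simpa [charPoly, Polynomial.eval_finsetSum] using hroot k

lemma exists_eq_sum_exp_of_Dop_eq_zero {n : ℕ} {a r : Fin (n + 1) → ℂ}
    (hroot : ∀ k, r k ^ (n + 1) + ∑ j : Fin (n + 1), a j * r k ^ (n - (j : ℕ)) = 0)
    (hinj : Function.Injective r) {z : ℝ → X} (hz : ContDiff ℝ (n + 1 : ℕ) z)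
    (hDz : Dop (n + 1) a z = 0) :
    ∃ c : Fin (n + 1) → X, ∀ t : ℝ, z t = ∑ k, Complex.exp (r k * t) • c k := by
  let L (k : Fin (n + 1)) : Polynomial ℂ := Lagrange.basis Finset.univ r k
  have hL (k) : Polynomial.X * L k
      = r k • L k + Lagrange.nodalWeight Finset.univ r k • charPoly a := by
    rw [charPoly_eq_nodal hroot hinj, Lagrange.nodal_eq_mul_nodal_erase (Finset.mem_univ k)]
    simp only [L]
    rw [Lagrange.basis_eq_prod_sub_inv_mul_nodal_div (Finset.mem_univ k),
      ← Lagrange.nodal_erase_eq_nodal_div (Finset.mem_univ k)]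
    simp only [Polynomial.smul_eq_C_mul]
    ring
  have hdeg (k) : (L k).coeff (n + 1) = 0 := by
    apply Polynomial.coeff_eq_zero_of_natDegree_lt
    simp [L, Lagrange.natDegree_basis hinj.injOn (Finset.mem_univ k)]
  have hw (k) (t : ℝ) : HasDerivAt (fun s => diffPoly (n + 2) z s (L k))
      (r k • diffPoly (n + 2) z t (L k)) t := by
    convert hasDerivAt_diffPoly hz (hdeg k) t using 1
    rw [hL, map_add, map_smul, map_smul, ← Dop_eq_diffPoly, hDz]
    simp
  refine ⟨fun k => diffPoly (n + 2) z 0 (L k), fun t => ?_⟩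
  calc z t = diffPoly (n + 2) z t (Polynomial.X ^ 0) := by
        rw [diffPoly_X_pow (by omega), iteratedDeriv_zero]
    _ = ∑ k, diffPoly (n + 2) z t (L k) := by
        rw [pow_zero, ← Lagrange.sum_basis hinj.injOn Finset.univ_nonempty, map_sum]
    _ = _ := Finset.sum_congr rfl fun k _ => eq_exp_smul_of_hasDerivAt (hw k) t

lemma exists_exp_mul_ne {p q : ℂ} (h : p ≠ q) :
    ∃ s : ℝ, Complex.exp (p * s) ≠ Complex.exp (q * s) := by
  by_contra! hall
  have hd (c : ℂ) : HasDerivAt (fun s : ℝ => Complex.exp (c * s)) c 0 := by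
    simpa using ((Complex.ofRealCLM.hasDerivAt (x := (0 : ℝ))).const_mul c).cexp
  refine h ((hd p).unique ?_)
  simpa only [hall] using hd q

lemma eq_zero_of_bounded_exp_smul {r : ℂ} (hr : 0 < r.re) {c : X} {M : ℝ}
    (hM : ∀ t : ℝ, ‖Complex.exp (r * t) • c‖ ≤ M) : c = 0 := by
  by_contra hc
  have hpos : 0 < ‖c‖ := norm_pos_iff.2 hc
  have h := hM (M / ‖c‖ / r.re)
  rw [norm_smul, Complex.norm_exp, Complex.re_mul_ofReal, mul_div_cancel₀ _ hr.ne'] at h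
  have h2 := mul_le_mul_of_nonneg_right (Real.add_one_le_exp (M / ‖c‖)) hpos.le
  rw [add_mul, div_mul_cancel₀ _ hpos.ne'] at h2
  linarith

lemma eq_zero_of_bounded_sum_exp {ι : Type*} {r : ι → ℂ} (hinj : Function.Injective r)
    (hre : ∀ k, 0 < (r k).re) (s : Finset ι) (c : ι → X) (M : ℝ)
    (hM : ∀ t : ℝ, ‖∑ k ∈ s, Complex.exp (r k * t) • c k‖ ≤ M) : ∀ k ∈ s, c k = 0 := by
  classical
  induction s using Finset.induction_on generalizing c M with
  | empty => simp
  | insert i s hi ih =>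
    have hs : ∀ k ∈ s, c k = 0 := by
      intro k hk
      obtain ⟨τ, hτ⟩ := exists_exp_mul_ne (hinj.ne (ne_of_mem_of_not_mem hk hi))
      have hz := ih (fun k => (Complex.exp (r k * τ) - Complex.exp (r i * τ)) • c k)
        (M + ‖Complex.exp (r i * τ)‖ * M) (fun t => ?_) k hk
      · exact (smul_eq_zero.1 hz).resolve_left (sub_ne_zero.2 hτ)
      · have heq : ∑ k ∈ s, Complex.exp (r k * t) •
              (Complex.exp (r k * τ) - Complex.exp (r i * τ)) • c k
            = ∑ k ∈ insert i s, Complex.exp (r k * ((t + τ : ℝ) : ℂ)) • c k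
              - Complex.exp (r i * τ) • ∑ k ∈ insert i s, Complex.exp (r k * t) • c k := by
          rw [Finset.smul_sum, ← Finset.sum_sub_distrib, Finset.sum_insert hi]
          have h0 (k) : Complex.exp (r k * ((t + τ : ℝ) : ℂ)) • c k
              - Complex.exp (r i * τ) • Complex.exp (r k * t) • c k
              = Complex.exp (r k * t) •
                (Complex.exp (r k * τ) - Complex.exp (r i * τ)) • c k := by
            rw [smul_smul, smul_smul, ← sub_smul, Complex.ofReal_add, mul_add, Complex.exp_add]
            ring_nf
          simp only [h0, sub_self, zero_smul, smul_zero, zero_add]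
        rw [heq]
        refine (norm_sub_le _ _).trans (add_le_add (hM _) ?_)
        rw [norm_smul]
        exact mul_le_mul_of_nonneg_left (hM t) (norm_nonneg _)
    have hi0 : c i = 0 := eq_zero_of_bounded_exp_smul (hre i) (M := M) fun t => by
      have h := hM t
      rwa [Finset.sum_insert hi, Finset.sum_eq_zero fun k hk => by rw [hs k hk, smul_zero],
        add_zero] at h
    intro k hk
    rcases Finset.mem_insert.1 hk with rfl | hk
    exacts [hi0, hs k hk]

lemma eq_zero_of_Dop_eq_zero_of_bounded {n : ℕ} {a r : Fin (n + 1) → ℂ}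
    (hroot : ∀ k, r k ^ (n + 1) + ∑ j : Fin (n + 1), a j * r k ^ (n - (j : ℕ)) = 0)
    (hinj : Function.Injective r) (hre : ∀ k, 0 < (r k).re)
    {z : ℝ → X} (hz : ContDiff ℝ (n + 1 : ℕ) z) (hDz : Dop (n + 1) a z = 0)
    {M : ℝ} (hM : ∀ t, ‖z t‖ ≤ M) : z = 0 := by
  obtain ⟨c, hc⟩ := exists_eq_sum_exp_of_Dop_eq_zero hroot hinj hz hDz
  have h0 := eq_zero_of_bounded_sum_exp hinj hre Finset.univ c M fun t => hc t ▸ hM t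
  funext t
  rw [hc t]
  exact Finset.sum_eq_zero fun k hk => by rw [h0 k hk, smul_zero]

end

section

variable {X : Type*} [NormedAddCommGroup X] [NormedSpace ℂ X]

lemma integrableOn_exp_smul {r : ℂ} (hr : 0 < r.re) {f : ℝ → X} (hf : Continuous f) {M : ℝ}
    (hM : ∀ t, ‖f t‖ ≤ M) (b : ℝ) :
    IntegrableOn (fun x : ℝ => Complex.exp (-r * x) • f x) (Set.Ioi b) := by
  have h := integrableOn_exp_mul_complex_Ioi (a := -r) (by simpa using hr) b
  exact h.smul_bdd M hf.aestronglyMeasurable (ae_of_all _ hM)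

/-- The bounded solution of `u' = r u + f` when `0 < r.re`. -/
noncomputable def expSol (r : ℂ) (f : ℝ → X) (t : ℝ) : X :=
  -∫ x in Set.Ioi (0 : ℝ), Complex.exp (-r * x) • f (t + x)

lemma expSol_eq (r : ℂ) (f : ℝ → X) (t : ℝ) :
    expSol r f t
      = -(Complex.exp (r * t) • ∫ x in Set.Ioi t, Complex.exp (-r * x) • f x) := by
  have h := (measurePreserving_add_left volume t).setIntegral_preimage_emb
    (measurableEmbedding_addLeft t) (fun x => Complex.exp (-r * x) • f x) (Set.Ioi t)
  simp only [Set.preimage_const_add_Ioi, sub_self] at h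
  rw [← h, expSol, ← integral_smul]
  congr 2
  funext x
  rw [smul_smul, ← Complex.exp_add]
  congr 2
  push_cast
  ring

lemma hasDerivAt_expSol [CompleteSpace X] {r : ℂ} (hr : 0 < r.re) {f : ℝ → X}
    (hf : Continuous f) {M : ℝ} (hM : ∀ t, ‖f t‖ ≤ M) (t : ℝ) :
    HasDerivAt (expSol r f) (r • expSol r f t + f t) t := by
  let g (x : ℝ) : X := Complex.exp (-r * x) • f x
  have hg : Continuous g := by fun_prop
  have hint : HasDerivAt (fun s => ∫ x in Set.Ioi s, g x) (-g t) t := by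
    have heq : (fun s => ∫ x in Set.Ioi s, g x)
        = fun s => (∫ x in Set.Ioi 0, g x) - ∫ x in (0 : ℝ)..s, g x := by
      funext s
      rw [← intervalIntegral.integral_interval_add_Ioi
        (integrableOn_exp_smul hr hf hM 0) (integrableOn_exp_smul hr hf hM s)]
      abel
    rw [heq]
    exact (hg.integral_hasStrictDerivAt 0 t).hasDerivAt.const_sub _
  have hexp : HasDerivAt (fun s : ℝ => Complex.exp (r * s)) (Complex.exp (r * t) * r) t := by
    simpa using ((Complex.ofRealCLM.hasDerivAt (x := t)).const_mul r).cexp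
  rw [show expSol r f = _ from funext (expSol_eq r f)]
  refine (hexp.smul hint).neg.congr_deriv ?_
  have h1 : Complex.exp (r * t) * Complex.exp (-r * t) = 1 := by
    rw [← Complex.exp_add]
    simp
  simp only [g, smul_neg, smul_smul, h1, one_smul]
  rw [mul_comm _ r, neg_add, neg_neg, add_comm]

lemma iteratedDeriv_eq_of_hasDerivAt {N : ℕ} {g : ℕ → ℝ → X}
    (hg : ∀ i < N, ∀ t, HasDerivAt (g i) (g (i + 1) t) t) {i : ℕ} (hi : i ≤ N) :
    iteratedDeriv i (g 0) = g i := by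
  induction i with
  | zero => exact iteratedDeriv_zero
  | succ i ih =>
    rw [iteratedDeriv_succ, ih (by omega)]
    exact funext fun t => (hg i hi t).deriv

lemma contDiff_of_hasDerivAt {N : ℕ} {g : ℕ → ℝ → X}
    (hg : ∀ i < N, ∀ t, HasDerivAt (g i) (g (i + 1) t) t) (hc : Continuous (g N)) :
    ContDiff ℝ N (g 0) := by
  refine contDiff_nat_iff_iteratedDeriv.2 ⟨fun m hm => ?_, fun m hm => ?_⟩
  · rw [iteratedDeriv_eq_of_hasDerivAt hg hm]
    rcases hm.eq_or_lt with rfl | hm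
    · exact hc
    · exact Differentiable.continuous (𝕜 := ℝ) fun t => (hg m hm t).differentiableAt
  · rw [iteratedDeriv_eq_of_hasDerivAt hg hm.le]
    exact fun t => (hg m hm t).differentiableAt

/-- If the weights `c` satisfy `∑ cₖ rₖⁱ = δᵢₙ` for `i ≤ n`, the superposition of the first-order
solutions solves `D(u) = f`. -/
lemma contDiff_and_Dop_sum_expSol [CompleteSpace X] {n : ℕ} {a r c : Fin (n + 1) → ℂ}
    (hroot : ∀ k, r k ^ (n + 1) + ∑ j : Fin (n + 1), a j * r k ^ (n - (j : ℕ)) = 0)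
    (hre : ∀ k, 0 < (r k).re)
    (hc : ∀ i ≤ n, ∑ k, c k * r k ^ i = if i = n then 1 else 0)
    {f : ℝ → X} (hf : Continuous f) {M : ℝ} (hM : ∀ t, ‖f t‖ ≤ M) :
    ContDiff ℝ (n + 1 : ℕ) (fun t => ∑ k, c k • expSol (r k) f t) ∧
      Dop (n + 1) a (fun t => ∑ k, c k • expSol (r k) f t) = f := by
  let g (i : ℕ) (t : ℝ) : X :=
    ∑ k, (c k * r k ^ i) • expSol (r k) f t + if i = n + 1 then f t else 0
  have hu (k) (t : ℝ) := hasDerivAt_expSol (hre k) hf hM t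
  have hg (i : ℕ) (hi : i < n + 1) (t : ℝ) : HasDerivAt (g i) (g (i + 1) t) t := by
    simp only [g, hi.ne, if_false, add_zero]
    refine (HasDerivAt.fun_sum fun k _ => (hu k t).const_smul _).congr_deriv ?_
    simp only [smul_add, Finset.sum_add_distrib, ← Finset.sum_smul, hc i (by omega), ite_smul,
      one_smul, zero_smul, smul_smul, pow_succ, mul_assoc, add_left_inj]
  have hg0 : g 0 = fun t => ∑ k, c k • expSol (r k) f t := by
    funext t
    simp [g]
  have hcont : Continuous (g (n + 1)) := by
    have h (k) : Continuous (expSol (r k) f) :=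
      Differentiable.continuous (𝕜 := ℝ) fun t => (hu k t).differentiableAt
    simp only [g, if_true]
    exact (continuous_finsetSum _ fun k _ => (h k).const_smul _).add hf
  rw [← hg0]
  refine ⟨contDiff_of_hasDerivAt hg hcont, funext fun t => ?_⟩
  have hiter (i : ℕ) (hi : i ≤ n + 1) := iteratedDeriv_eq_of_hasDerivAt hg hi
  have hlow (j : Fin (n + 1)) : iteratedDeriv (n - (j : ℕ)) (g 0) t
      = ∑ k, (c k * r k ^ (n - (j : ℕ))) • expSol (r k) f t := by
    rw [hiter _ (by omega)]
    simp only [g]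
    rw [if_neg (by omega), add_zero]
  simp only [Dop, Nat.add_sub_cancel, hlow, hiter _ le_rfl]
  simp only [g, if_true, Finset.smul_sum]
  rw [Finset.sum_comm, add_right_comm, ← Finset.sum_add_distrib]
  refine add_eq_right.2 (Finset.sum_eq_zero fun k _ => ?_)
  simp only [smul_smul, ← Finset.sum_smul, ← add_smul]
  have h0 : c k * r k ^ (n + 1) + ∑ j : Fin (n + 1), a j * (c k * r k ^ (n - (j : ℕ))) = 0 := by
    rw [← mul_zero (c k), ← hroot k, mul_add, Finset.mul_sum]
    simp only [mul_left_comm]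
  rw [h0, zero_smul]

lemma sum_VandDel_mul {n : ℕ} (r : Fin (n + 1) → ℂ) {i : ℕ} (hi : i ≤ n) :
    ∑ k : Fin (n + 1), (-1 : ℂ) ^ ((k : ℕ) + n) * VandDel r k * r k ^ i
      = if i = n then (Matrix.vandermonde r).det else 0 := by
  let A : Matrix (Fin (n + 1)) (Fin (n + 1)) ℂ :=
    (Matrix.vandermonde r).updateCol (Fin.last n) fun k => r k ^ i
  have hA : A.det = ∑ k : Fin (n + 1), (-1 : ℂ) ^ ((k : ℕ) + n) * VandDel r k * r k ^ i := by
    rw [Matrix.det_succ_column A (Fin.last n)]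
    refine Finset.sum_congr rfl fun k _ => ?_
    have hsub : A.submatrix k.succAbove (Fin.last n).succAbove
        = Matrix.vandermonde fun i => r (k.succAbove i) := by
      ext p q
      simp [A, Matrix.vandermonde_apply, (Fin.castSucc_lt_last q).ne]
    rw [hsub, VandDel]
    simp only [A, Matrix.updateCol_self, Fin.val_last]
    ring
  rw [← hA]
  split_ifs with h
  · congr 1
    ext p q
    by_cases hq : q = Fin.last n <;> simp [A, Matrix.vandermonde_apply, hq, h]
  · have hlt : i < n := by omega
    refine Matrix.det_zero_of_column_eq (i := ⟨i, by omega⟩) (j := Fin.last n)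
      (by simp [Fin.ext_iff, h]) fun k => ?_
    simp [A, Matrix.vandermonde_apply, Fin.ext_iff, h]

end

section

variable {X : Type*} [NormedAddCommGroup X] [NormedSpace ℂ X]

/-- The exponential sum `∑ cₖ exp(-rₖ x)`. -/
noncomputable def expSum {ι : Type*} [Fintype ι] (c r : ι → ℂ) (x : ℝ) : ℂ :=
  ∑ k, c k * Complex.exp (-(r k) * x)

lemma continuous_expSum {ι : Type*} [Fintype ι] (c r : ι → ℂ) : Continuous (expSum c r) := by
  unfold expSum
  fun_prop

lemma integrableOn_expSum {ι : Type*} [Fintype ι] (c : ι → ℂ) {r : ι → ℂ}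
    (hre : ∀ k, 0 < (r k).re) : IntegrableOn (expSum c r) (Set.Ioi 0) :=
  integrable_finsetSum _ fun k _ =>
    (integrableOn_exp_mul_complex_Ioi (a := -(r k)) (by simpa using hre k) 0).const_mul (c k)

lemma sum_expSol_eq {ι : Type*} [Fintype ι] (c : ι → ℂ) {r : ι → ℂ}
    (hre : ∀ k, 0 < (r k).re) {f : ℝ → X} (hf : Continuous f) {M : ℝ} (hM : ∀ t, ‖f t‖ ≤ M)
    (t : ℝ) :
    ∑ k, c k • expSol (r k) f t = -∫ x in Set.Ioi (0 : ℝ), expSum c r x • f (t + x) := by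
  simp only [expSol, expSum, Finset.sum_smul, mul_smul, smul_neg, Finset.sum_neg_distrib]
  rw [integral_finsetSum]
  · simp only [integral_smul]
  · intro k _
    exact (integrableOn_exp_smul (hre k) (f := fun x => f (t + x)) (by fun_prop)
      (fun x => hM _) 0).smul (c k)

lemma norm_sum_expSol_le {ι : Type*} [Fintype ι] (c : ι → ℂ) {r : ι → ℂ}
    (hre : ∀ k, 0 < (r k).re) {f : ℝ → X} (hf : Continuous f) {M : ℝ} (hM : ∀ t, ‖f t‖ ≤ M)
    (t : ℝ) :
    ‖∑ k, c k • expSol (r k) f t‖ ≤ (∫ x in Set.Ioi (0 : ℝ), ‖expSum c r x‖) * M := by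
  rw [sum_expSol_eq c hre hf hM, norm_neg, ← integral_mul_const]
  refine norm_integral_le_of_norm_le ((integrableOn_expSum c hre).norm.mul_const M)
    (ae_of_all _ fun x => ?_)
  rw [norm_smul]
  exact mul_le_mul_of_nonneg_left (hM _) (norm_nonneg _)

/-- A bounded continuous right-hand side nearly aligned with the conjugate of the kernel. -/
lemma exists_le_norm_sum_expSol [CompleteSpace X] [Nontrivial X] {ι : Type*} [Fintype ι]
    (c : ι → ℂ) {r : ι → ℂ}
    (hre : ∀ k, 0 < (r k).re) {δ : ℝ} (hδ : 0 < δ) :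
    ∃ f : ℝ → X, Continuous f ∧ (∀ t, ‖f t‖ ≤ 1) ∧
      (∫ x in Set.Ioi (0 : ℝ), ‖expSum c r x‖) - δ ≤ ‖∑ k, c k • expSol (r k) f 0‖ := by
  obtain ⟨u, hu⟩ : ∃ u : X, ‖u‖ = 1 := by
    obtain ⟨v, hv⟩ := exists_ne (0 : X)
    exact ⟨((‖v‖⁻¹ : ℝ) : ℂ) • v, by simp [norm_smul, hv]⟩
  let G := expSum c r
  have hG : Continuous G := continuous_expSum c r
  let d (x : ℝ) : ℝ := ‖G x‖ + δ * Real.exp (-x)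
  have hd (x : ℝ) : 0 < d x := by positivity
  have hdc : Continuous d := by fun_prop
  let φ (x : ℝ) : ℂ := starRingEnd ℂ (G x) / (d x : ℂ)
  have hφ : Continuous φ :=
    (Complex.continuous_conj.comp hG).div (Complex.continuous_ofReal.comp hdc)
      fun x => Complex.ofReal_ne_zero.2 (hd x).ne'
  have hφ1 (x : ℝ) : ‖φ x‖ ≤ 1 := by
    have h1 : ‖G x‖ ≤ d x := le_add_of_nonneg_right (by positivity)
    simpa [φ, abs_of_pos (hd x)] using div_le_one_of_le₀ h1 (hd x).le
  have hf : Continuous fun x => φ x • u := by fun_prop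
  have hf1 (x : ℝ) : ‖φ x • u‖ ≤ 1 := by simpa [norm_smul, hu] using hφ1 x
  refine ⟨fun x => φ x • u, hf, hf1, ?_⟩
  have hGφ (x : ℝ) : G x * φ x = ((‖G x‖ ^ 2 / d x : ℝ) : ℂ) := by
    simp only [φ]
    rw [← mul_div_assoc, Complex.mul_conj, Complex.normSq_eq_norm_sq, Complex.ofReal_div]
  have hGint : IntegrableOn (fun x => ‖G x‖) (Set.Ioi 0) := (integrableOn_expSum c hre).norm
  have hint : IntegrableOn (fun x => ‖G x‖ ^ 2 / d x) (Set.Ioi 0) := by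
    refine hGint.mono' ((hG.norm.pow 2).div hdc fun x => (hd x).ne').aestronglyMeasurable
      (ae_of_all _ fun x => ?_)
    rw [Real.norm_of_nonneg (by have := hd x; positivity), div_le_iff₀ (hd x)]
    simp only [d]
    nlinarith [mul_nonneg (norm_nonneg (G x)) (mul_pos hδ (Real.exp_pos (-x))).le]
  have hexp : IntegrableOn (fun x : ℝ => δ * Real.exp (-x)) (Set.Ioi 0) :=
    (integrableOn_exp_neg_Ioi 0).const_mul δ
  calc (∫ x in Set.Ioi (0 : ℝ), ‖G x‖) - δ
      = ∫ x in Set.Ioi (0 : ℝ), (‖G x‖ - δ * Real.exp (-x)) := by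
        rw [integral_sub hGint hexp, integral_const_mul, integral_exp_neg_Ioi_zero, mul_one]
    _ ≤ ∫ x in Set.Ioi (0 : ℝ), ‖G x‖ ^ 2 / d x := by
        refine integral_mono (hGint.sub hexp) hint fun x => ?_
        simp only
        rw [le_div_iff₀ (hd x)]
        simp only [d]
        nlinarith [sq_nonneg (δ * Real.exp (-x))]
    _ ≤ ‖∑ k, c k • expSol (r k) (fun x => φ x • u) 0‖ := by
        rw [sum_expSol_eq c hre hf hf1, norm_neg]
        simp only [zero_add, smul_smul]
        rw [integral_smul_const, norm_smul, hu, mul_one]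
        change _ ≤ ‖∫ x in Set.Ioi (0 : ℝ), G x * φ x‖
        simp only [hGφ]
        rw [integral_complex_ofReal, Complex.norm_real]
        exact le_abs_self _

lemma Dop_sub {n : ℕ} (a : Fin (n + 1) → ℂ) {y z : ℝ → X} (hy : ContDiff ℝ (n + 1 : ℕ) y)
    (hz : ContDiff ℝ (n + 1 : ℕ) z) :
    Dop (n + 1) a (y - z) = Dop (n + 1) a y - Dop (n + 1) a z := by
  funext t
  have h (i : ℕ) (hi : i ≤ n + 1) :
      iteratedDeriv i (y - z) t = iteratedDeriv i y t - iteratedDeriv i z t :=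
    iteratedDeriv_sub (hy.contDiffAt.of_le (by exact_mod_cast hi))
      (hz.contDiffAt.of_le (by exact_mod_cast hi))
  have hlow (j : Fin (n + 1)) := h (n + 1 - 1 - (j : ℕ)) (by omega)
  simp only [Dop, Pi.sub_apply, h _ le_rfl, hlow, smul_sub, Finset.sum_sub_distrib]
  abel

lemma continuous_Dop {n : ℕ} (a : Fin (n + 1) → ℂ) {y : ℝ → X}
    (hy : ContDiff ℝ (n + 1 : ℕ) y) : Continuous (Dop (n + 1) a y) := by
  have h := (contDiff_nat_iff_iteratedDeriv.1 hy).1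
  exact (h _ le_rfl).add
    (continuous_finsetSum _ fun j _ => (h _ (by omega)).const_smul (a j))

end

theorem stmt5 {X : Type*} [NormedAddCommGroup X] [NormedSpace ℂ X] [CompleteSpace X] [Nontrivial X]
    (n : ℕ) (a : Fin (n + 1) → ℂ) (r : Fin (n + 1) → ℂ)
    (hroot : ∀ k, r k ^ (n + 1) + ∑ j : Fin (n + 1), a j * r k ^ (n - (j : ℕ)) = 0)
    (hinj : Function.Injective r)
    (hre : ∀ k, 0 < (r k).re)
    (KD : ℝ)
    (hKD : KD = (1 / ‖(Matrix.vandermonde r).det‖) *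
      ∫ x in Set.Ioi (0 : ℝ), ‖∑ k : Fin (n + 1), (-1 : ℂ) ^ ((k : ℕ) + 1) *
        VandDel r k * Complex.exp (-(r k) * x)‖) :
    IsUlamConstant (X := X) (n + 1) a KD ∧
      ∀ K : ℝ, IsUlamConstant (X := X) (n + 1) a K → KD ≤ K := by
  let V := (Matrix.vandermonde r).det
  have hV : V ≠ 0 := Matrix.det_vandermonde_ne_zero_iff.2 hinj
  let c (k : Fin (n + 1)) : ℂ := (-1) ^ ((k : ℕ) + n) * VandDel r k / V
  have hc (i : ℕ) (hi : i ≤ n) : ∑ k, c k * r k ^ i = if i = n then 1 else 0 := by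
    simp only [c, div_mul_eq_mul_div]
    rw [← Finset.sum_div, sum_VandDel_mul r hi, ite_div, zero_div]
    simp only [V, div_self hV]
  have hK : KD = ∫ x in Set.Ioi (0 : ℝ), ‖expSum c r x‖ := by
    rw [hKD, ← integral_const_mul]
    congr 1
    funext x
    have h : expSum c r x = (-1) ^ (n + 1) / V * ∑ k : Fin (n + 1), (-1 : ℂ) ^ ((k : ℕ) + 1) *
        VandDel r k * Complex.exp (-(r k) * x) := by
      rw [expSum, Finset.mul_sum]
      refine Finset.sum_congr rfl fun k _ => ?_
      simp only [c, pow_add]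
      ring
    rw [h, norm_mul, norm_div, norm_pow, norm_neg, norm_one, one_pow]
  refine ⟨⟨hK ▸ integral_nonneg fun x => norm_nonneg _, fun ε _ y hy hDy => ?_⟩,
    fun K hUlam => le_of_forall_pos_sub_le fun δ hδ => ?_⟩
  · obtain ⟨hu, hDu⟩ := contDiff_and_Dop_sum_expSol hroot hre hc (continuous_Dop a hy) hDy
    refine ⟨_, hy.sub hu, (Dop_sub a hy hu).trans (by rw [hDu, sub_self]), fun t => ?_⟩
    simp only [sub_sub_cancel, hK]
    exact norm_sum_expSol_le c hre (continuous_Dop a hy) hDy t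
  · obtain ⟨f, hf, hf1, hle⟩ := exists_le_norm_sum_expSol (X := X) c hre hδ
    obtain ⟨hu, hDu⟩ := contDiff_and_Dop_sum_expSol hroot hre hc hf hf1
    obtain ⟨z, hz, hDz, hzK⟩ := hUlam.2 1 one_pos _ hu (fun t => by rw [hDu]; exact hf1 t)
    have hz0 : z = 0 := by
      refine eq_zero_of_Dop_eq_zero_of_bounded hroot hinj hre hz hDz (M := K * 1 + KD * 1)
        fun t => ?_
      have h := norm_sum_expSol_le c hre hf hf1 t
      rw [← hK] at h
      exact (norm_le_norm_sub_add _ _).trans (add_le_add (norm_sub_rev (z t) _ ▸ hzK t) h)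
    have h := hzK 0
    rw [hz0, Pi.zero_apply, sub_zero, mul_one] at h
    rw [hK]
    exact hle.trans h
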